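/- For every j ≥ 0 and every z ∈ ℝ, the set D̲^z_{≤j} of functions of the form ξ = z·id + ξ', where ξ' is a nondecreasing piecewise constant càdlàg function on [0,1] with at most j discontinuities (counting a jump at 0 when ξ'(0) ≠ 0), is closed in (D[0,1], d_{M_1'}). -/

import Mathlib

open Set Filter Topology

noncomputable section

/-- `ξ(t⁻)` with the convention `ξ(0⁻) = 0`. -/
def leftVal (ξ : ℝ → ℝ) (t : ℝ) : ℝ := if t = 0 then 0 else Function.leftLim ξ t

/-- A càdlàg function on `[0,1]`: right-continuous on `[0,1)` with left limits on `(0,1]`. -/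
def IsCadlag (ξ : ℝ → ℝ) : Prop :=
  (∀ t ∈ Ico (0:ℝ) 1, Tendsto ξ (nhdsWithin t (Ioi t)) (nhds (ξ t))) ∧
  (∀ t ∈ Ioc (0:ℝ) 1, ∃ l : ℝ, Tendsto ξ (nhdsWithin t (Iio t)) (nhds l))

/-- The extended completed graph `Γ'_ξ` of `ξ` (with `ξ(0⁻) = 0`). -/
def extGraph (ξ : ℝ → ℝ) : Set (ℝ × ℝ) :=
  {p | p.2 ∈ Icc (0:ℝ) 1 ∧
    p.1 ∈ Icc (min (leftVal ξ p.2) (ξ p.2)) (max (leftVal ξ p.2) (ξ p.2))}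

/-- `(u, v)` is a parametric representation of `ξ`: a continuous map of `[0,1]` onto `Γ'_ξ`
which is nondecreasing for the order on the graph. -/
def ParamRep (ξ u v : ℝ → ℝ) : Prop :=
  ContinuousOn u (Icc 0 1) ∧ ContinuousOn v (Icc 0 1) ∧
  (fun s => (u s, v s)) '' Icc (0:ℝ) 1 = extGraph ξ ∧
  ∀ s₁ ∈ Icc (0:ℝ) 1, ∀ s₂ ∈ Icc (0:ℝ) 1, s₁ ≤ s₂ →
    v s₁ < v s₂ ∨ (v s₁ = v s₂ ∧ |leftVal ξ (v s₁) - u s₁| ≤ |leftVal ξ (v s₂) - u s₂|)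

/-- The `M₁'` metric on `D[0,1]`. -/
def dM1 (ξ ζ : ℝ → ℝ) : ℝ :=
  sInf { r | ∃ u₁ v₁ u₂ v₂ : ℝ → ℝ, ParamRep ξ u₁ v₁ ∧ ParamRep ζ u₂ v₂ ∧
    r = max (⨆ s : Icc (0:ℝ) 1, |u₁ s - u₂ s|) (⨆ s : Icc (0:ℝ) 1, |v₁ s - v₂ s|) }

/-- The Skorokhod `J₁` metric on `D[0,1]`. -/
def dJ1 (ξ ζ : ℝ → ℝ) : ℝ :=
  sInf { r | ∃ lam : ℝ → ℝ, ContinuousOn lam (Icc 0 1) ∧ StrictMonoOn lam (Icc 0 1) ∧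
    lam '' Icc (0:ℝ) 1 = Icc (0:ℝ) 1 ∧
    r = max (⨆ s : Icc (0:ℝ) 1, |lam s - (s:ℝ)|) (⨆ s : Icc (0:ℝ) 1, |ξ (lam s) - ζ s|) }

/-- The set of discontinuities of `ξ` in `[0,1]` (with `ξ(0⁻) = 0`). -/
def Disc (ξ : ℝ → ℝ) : Set ℝ := {t ∈ Icc (0:ℝ) 1 | ξ t ≠ leftVal ξ t}

end

noncomputable section

open Set

/-- `ξ` is piecewise constant on `[0,1]`: there are `0 = t₀ < t₁ < ⋯ < t_m = 1` with `ξ`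
constant on each `[t_{i-1}, t_i)`. -/
def PiecewiseConstant (ξ : ℝ → ℝ) : Prop :=
  ∃ (m : ℕ) (t : ℕ → ℝ), 0 < m ∧ t 0 = 0 ∧ t m = 1 ∧ (∀ i < m, t i < t (i + 1)) ∧
    ∀ i < m, ∀ s₁ ∈ Ico (t i) (t (i + 1)), ∀ s₂ ∈ Ico (t i) (t (i + 1)), ξ s₁ = ξ s₂

/-- `D̲_{≤ j}`: nondecreasing piecewise constant functions with at most `j` discontinuities
(a nonzero value at `0` counts as a jump, via the convention `ξ(0⁻) = 0`). -/
def Dle (j : ℕ) : Set (ℝ → ℝ) :=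
  {ξ | PiecewiseConstant ξ ∧ MonotoneOn ξ (Icc 0 1) ∧ 0 ≤ ξ 0 ∧
    (Disc ξ).Finite ∧ (Disc ξ).ncard ≤ j}

/-- `D̲^z_{≤ j} = {z·id + ξ' : ξ' ∈ D̲_{≤ j}}`. -/
def DleZ (z : ℝ) (j : ℕ) : Set (ℝ → ℝ) :=
  {ξ | ∃ ξ' ∈ Dle j, ξ = fun t => z * t + ξ' t}

/-- `D̲_{≪ j}`: piecewise constant functions with strictly fewer than `j` discontinuities. -/
def Dll (j : ℕ) : Set (ℝ → ℝ) :=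
  {ξ | PiecewiseConstant ξ ∧ (Disc ξ).Finite ∧ (Disc ξ).ncard < j}

/-- `D̲^z_{≪ j} = {z·id + ξ' : ξ' ∈ D̲_{≪ j}}`. -/
def DllZ (z : ℝ) (j : ℕ) : Set (ℝ → ℝ) :=
  {ξ | ∃ ξ' ∈ Dll j, ξ = fun t => z * t + ξ' t}

end

theorem IsCadlag.tendsto_leftVal {ζ : ℝ → ℝ} (hζ : IsCadlag ζ) {t : ℝ} (ht : t ∈ Ioc (0:ℝ) 1) :
    Tendsto ζ (𝓝[<] t) (𝓝 (leftVal ζ t)) := by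
  rw [leftVal, if_neg ht.1.ne']
  exact tendsto_leftLim_of_tendsto (hζ.2 t ht)

theorem leftVal_eq_of_tendsto {ζ : ℝ → ℝ} {t l : ℝ} (ht : t ≠ 0) (h : Tendsto ζ (𝓝[<] t) (𝓝 l)) :
    leftVal ζ t = l := by
  rw [leftVal, if_neg ht]
  exact leftLim_eq_of_tendsto h

theorem IsCadlag.abs_leftVal_sub_le {ζ : ℝ → ℝ} (hζ : IsCadlag ζ) {p r c ε : ℝ}
    (hr : r ∈ Ioc (0:ℝ) 1) (hpr : p < r) (h : ∀ s ∈ Ioo p r, |ζ s - c| ≤ ε) :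
    |leftVal ζ r - c| ≤ ε :=
  le_of_tendsto ((hζ.tendsto_leftVal hr).sub_const c).abs
    (by filter_upwards [Ioo_mem_nhdsLT hpr] using h)

/-- Near `t`, a càdlàg function and its left limits stay close to `ζ t` on the right of `t`, and
close to `ζ(t⁻)` on the left of `t`. -/
theorem IsCadlag.exists_oscillation_le {ζ : ℝ → ℝ} (hζ : IsCadlag ζ) {t : ℝ}
    (ht : t ∈ Icc (0:ℝ) 1) {ε : ℝ} (hε : 0 < ε) :
    ∃ δ > 0, ∀ r ∈ Icc (0:ℝ) 1, |r - t| < δ →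
      (t < r → |ζ r - ζ t| ≤ ε ∧ |leftVal ζ r - ζ t| ≤ ε) ∧
      (r < t → |ζ r - leftVal ζ t| ≤ ε ∧ |leftVal ζ r - leftVal ζ t| ≤ ε) := by
  have hR : ∃ δ > 0, ∀ r ∈ Icc (0:ℝ) 1, |r - t| < δ → t < r →
      |ζ r - ζ t| ≤ ε ∧ |leftVal ζ r - ζ t| ≤ ε := by
    rcases eq_or_lt_of_le ht.2 with h1 | h1
    · exact ⟨1, one_pos, fun r hr _ htr => absurd hr.2 (by linarith)⟩
    have hev : ∀ᶠ r in 𝓝[>] t, |ζ r - ζ t| < ε := by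
      simpa only [Real.dist_eq] using Metric.tendsto_nhds.1 (hζ.1 t ⟨ht.1, h1⟩) ε hε
    obtain ⟨q, hq, hsub⟩ := mem_nhdsGT_iff_exists_Ioo_subset.1 hev
    refine ⟨q - t, sub_pos.2 hq, fun r hr hrt htr => ?_⟩
    have hrq : r < q := by linarith [le_abs_self (r - t)]
    refine ⟨le_of_lt (hsub ⟨htr, hrq⟩), ?_⟩
    exact hζ.abs_leftVal_sub_le ⟨ht.1.trans_lt htr, hr.2⟩ htr
      fun s hs => le_of_lt (hsub ⟨hs.1, hs.2.trans hrq⟩)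
  have hL : ∃ δ > 0, ∀ r ∈ Icc (0:ℝ) 1, |r - t| < δ → r < t →
      |ζ r - leftVal ζ t| ≤ ε ∧ |leftVal ζ r - leftVal ζ t| ≤ ε := by
    rcases eq_or_lt_of_le ht.1 with h0 | h0
    · exact ⟨1, one_pos, fun r hr _ htr => absurd hr.1 (by linarith)⟩
    have hev : ∀ᶠ r in 𝓝[<] t, |ζ r - leftVal ζ t| < ε := by
      simpa only [Real.dist_eq] using
        Metric.tendsto_nhds.1 (hζ.tendsto_leftVal ⟨h0, ht.2⟩) ε hε
    obtain ⟨q, hq, hsub⟩ := mem_nhdsLT_iff_exists_Ioo_subset.1 hev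
    refine ⟨min (t - q) t, lt_min (sub_pos.2 hq) h0, fun r hr hrt htr => ?_⟩
    have h1 := neg_abs_le (r - t)
    have hrq : q < r := by linarith [min_le_left (t - q) t]
    have hr0 : 0 < r := by linarith [min_le_right (t - q) t]
    refine ⟨le_of_lt (hsub ⟨hrq, htr⟩), ?_⟩
    exact hζ.abs_leftVal_sub_le ⟨hr0, hr.2⟩ hrq
      fun s hs => le_of_lt (hsub ⟨hs.1, hs.2.trans htr⟩)
  obtain ⟨δ₁, h₁, hR⟩ := hR
  obtain ⟨δ₂, h₂, hL⟩ := hL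
  exact ⟨min δ₁ δ₂, lt_min h₁ h₂, fun r hr hrt =>
    ⟨hR r hr (hrt.trans_le (min_le_left _ _)), hL r hr (hrt.trans_le (min_le_right _ _))⟩⟩

theorem IsCadlag.countable_Disc {ζ : ℝ → ℝ} (hζ : IsCadlag ζ) : (Disc ζ).Countable := by
  set S : ℕ → Set ℝ := fun k => {t | t ∈ Icc (0:ℝ) 1 ∧ 1 / ((k:ℝ) + 1) < |ζ t - leftVal ζ t|}
  have hS : ∀ k, (S k).Countable := by
    intro k
    refine (countable_setOfPred_isolated_right_within (s := S k)).mono ?_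
    intro t ht
    refine ⟨ht, ?_⟩
    have hk : (0:ℝ) < 1 / ((k:ℝ) + 1) / 2 := by positivity
    obtain ⟨δ, hδ, h⟩ := hζ.exists_oscillation_le ht.1 hk
    rw [← empty_mem_iff_bot, mem_nhdsWithin]
    refine ⟨Metric.ball t δ, Metric.isOpen_ball, Metric.mem_ball_self hδ, ?_⟩
    rintro r ⟨hr, hrS, htr⟩
    obtain ⟨h1, h2⟩ := (h r hrS.1 (by simpa [Real.dist_eq] using hr)).1 htr
    have h3 := hrS.2
    have h4 := abs_sub_le (ζ r) (ζ t) (leftVal ζ r)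
    rw [abs_sub_comm (ζ t)] at h4
    exact absurd h3 (by linarith)
  refine (countable_iUnion hS).mono fun t ht => ?_
  obtain ⟨k, hk⟩ := exists_nat_one_div_lt (abs_pos.2 (sub_ne_zero.2 ht.2))
  exact mem_iUnion.2 ⟨k, ht.1, hk⟩

/-- A time change `[L t, R t]` opening up every time `t` of a countable set `D`. -/
theorem exists_time_change {D : Set ℝ} (hD : D.Countable) (hD01 : D ⊆ Icc 0 1) :
    ∃ (L R : ℝ → ℝ) (c : ℝ), 0 < c ∧ L 0 = 0 ∧ R 1 = 1 ∧ (∀ t, L t ≤ R t) ∧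
      (∀ t ∈ D, L t < R t) ∧ (∀ t t', t < t' → c * (t' - t) ≤ L t' - R t) ∧
      (∀ t, Tendsto L (𝓝[<] t) (𝓝 (L t))) ∧ (∀ t, Tendsto L (𝓝[>] t) (𝓝 (R t))) := by
  classical
  obtain ⟨e, hpos, W, hW, -⟩ := hD.exists_pos_hasSum_le one_pos
  set w : ℝ → ℝ := D.indicator e
  have hw0 : ∀ d, 0 ≤ w d := fun d => indicator_nonneg (fun _ _ => (hpos _).le) d
  have hws : Summable w := summable_subtype_iff_indicator.1 hW.summable
  have hsum : ∀ P : ℝ → Prop, Summable fun d => if P d then w d else 0 := fun P => by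
    refine hws.of_nonneg_of_le (fun d => ?_) (fun d => ?_) <;> split_ifs <;> simp [hw0]
  set A : ℝ → ℝ := fun t => ∑' d, if d < t then w d else 0
  set B : ℝ → ℝ := fun t => ∑' d, if d ≤ t then w d else 0
  have hAB : ∀ t, B t = A t + w t := by
    intro t
    have h1 : HasSum (fun d => if d = t then w t else 0) (w t) := hasSum_ite_eq t (w t)
    rw [← ((hsum (· < t)).hasSum.add h1).tsum_eq]
    refine tsum_congr fun d => ?_
    rcases lt_trichotomy d t with h | rfl | h
    · simp [h, h.le, h.ne]
    · simp
    · simp [h.not_gt, h.not_ge, h.ne']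
  have hBA : ∀ t t', t < t' → B t ≤ A t' := fun t t' h =>
    (hsum _).tsum_le_tsum (fun d => by
      by_cases hd : d ≤ t
      · simp [hd, hd.trans_lt h]
      · simp only [hd, if_false]; split_ifs <;> simp [hw0]) (hsum _)
  have hA0 : A 0 = 0 := by
    have : ∀ d, (if d < 0 then w d else 0) = 0 := fun d => by
      split_ifs with hd
      · exact indicator_of_notMem (fun h => absurd (hD01 h).1 (not_le.2 hd)) _
      · rfl
    simp [A, this]
  have hB1 : 0 ≤ B 1 := tsum_nonneg fun d => by split_ifs <;> simp [hw0]
  have hlim : ∀ (l : Filter ℝ) (P : ℝ → Prop), (∀ d, ∀ᶠ r in l, (d < r ↔ P d)) →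
      Tendsto A l (𝓝 (∑' d, if P d then w d else 0)) := by
    intro l P hP
    refine tendsto_tsum_of_dominated_convergence (bound := w) hws (fun d => ?_) ?_
    · refine tendsto_const_nhds.congr' ?_
      filter_upwards [hP d] with r hr
      simp [hr]
    · refine Eventually.of_forall fun r d => ?_
      split_ifs <;> simp [hw0, abs_of_nonneg]
  have hc : 0 < 1 + B 1 := by linarith
  refine ⟨fun t => (t + A t) / (1 + B 1), fun t => (t + B t) / (1 + B 1), (1 + B 1)⁻¹,
    inv_pos.2 hc, by simp [hA0], div_self hc.ne', fun t => ?_, fun t ht => ?_, fun t t' h => ?_,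
    fun t => ?_, fun t => ?_⟩
  · have := hw0 t
    have := hAB t
    exact div_le_div_of_nonneg_right (by linarith) hc.le
  · have : 0 < w t := by simpa only [w, indicator_of_mem ht] using hpos t
    have := hAB t
    exact div_lt_div_of_pos_right (by linarith) hc
  · have := hBA t t' h
    rw [← sub_div, inv_mul_eq_div]
    exact div_le_div_of_nonneg_right (by linarith) hc.le
  · refine ((tendsto_id.mono_left nhdsWithin_le_nhds).add (hlim _ (· < t) fun d => ?_)).div_const _
    by_cases hd : d < t
    · filter_upwards [Ioo_mem_nhdsLT hd] with r hr
      simp [hr.1, hd]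
    · filter_upwards [self_mem_nhdsWithin] with r hr
      simp only [hd, iff_false, not_lt]
      exact hr.le.trans (not_lt.1 hd)
  · refine ((tendsto_id.mono_left nhdsWithin_le_nhds).add (hlim _ (· ≤ t) fun d => ?_)).div_const _
    by_cases hd : d ≤ t
    · filter_upwards [self_mem_nhdsWithin] with r hr
      simp [hd.trans_lt hr, hd]
    · filter_upwards [Ioo_mem_nhdsGT (not_le.1 hd)] with r hr
      simp [hd, hr.2.le]

theorem exists_mem_time_interval {L R : ℝ → ℝ} (hL0 : L 0 = 0) (hR1 : R 1 = 1)
    (hmono : ∀ t t', t < t' → R t ≤ L t') (hLR : ∀ t, L t ≤ R t)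
    (hleft : ∀ t, Tendsto L (𝓝[<] t) (𝓝 (L t))) (hright : ∀ t, Tendsto L (𝓝[>] t) (𝓝 (R t)))
    {s : ℝ} (hs : s ∈ Icc (0:ℝ) 1) : ∃ t ∈ Icc (0:ℝ) 1, L t ≤ s ∧ s ≤ R t := by
  set S : Set ℝ := {r | r ∈ Icc (0:ℝ) 1 ∧ L r ≤ s}
  have h0 : (0:ℝ) ∈ S := ⟨⟨le_rfl, zero_le_one⟩, hL0.trans_le hs.1⟩
  have hbdd : BddAbove S := ⟨1, fun r hr => hr.1.2⟩
  have hlt : ∀ r, r < sSup S → L r ≤ s := fun r hr => by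
    obtain ⟨q, hq, hrq⟩ := exists_lt_of_lt_csSup ⟨0, h0⟩ hr
    exact ((hLR r).trans (hmono r q hrq)).trans hq.2
  have ht1 : sSup S ≤ 1 := csSup_le ⟨0, h0⟩ fun r hr => hr.1.2
  refine ⟨sSup S, ⟨le_csSup hbdd h0, ht1⟩, ?_, ?_⟩
  · exact le_of_tendsto (hleft _) (by filter_upwards [self_mem_nhdsWithin] using hlt)
  · rcases eq_or_lt_of_le ht1 with h1 | h1
    · rw [h1, hR1]
      exact hs.2
    · refine ge_of_tendsto (hright _) ?_
      filter_upwards [Ioo_mem_nhdsGT h1] with r hr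
      by_contra! hrs
      exact absurd (le_csSup hbdd ⟨⟨(le_csSup hbdd h0).trans hr.1.le, hr.2.le⟩, hrs.le⟩)
        (not_le.2 hr.1)

theorem abs_convexComb_sub_le {a b c θ ε : ℝ} (hθ : θ ∈ Icc (0:ℝ) 1) (ha : |a - c| ≤ ε)
    (hb : |b - c| ≤ ε) : |a + θ * (b - a) - c| ≤ ε := by
  have h : a + θ * (b - a) - c = (1 - θ) * (a - c) + θ * (b - c) := by ring
  rw [abs_le] at *
  obtain ⟨h0, h1⟩ := hθ
  constructor <;> rw [h] <;> nlinarith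

theorem IsCadlag.exists_paramRep {ζ : ℝ → ℝ} (hζ : IsCadlag ζ) : ∃ u v, ParamRep ζ u v := by
  obtain ⟨L, R, c, hc, hL0, hR1, hLR, hD, hgap, hleft, hright⟩ :=
    exists_time_change hζ.countable_Disc fun t ht => ht.1
  have hmono : ∀ t t', t < t' → R t ≤ L t' := fun t t' h => by
    have := hgap t t' h
    have := mul_pos hc (sub_pos.2 h)
    linarith
  have hex : ∀ s, ∃ t, s ∈ Icc (0:ℝ) 1 → t ∈ Icc (0:ℝ) 1 ∧ L t ≤ s ∧ s ≤ R t := fun s => by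
    by_cases hs : s ∈ Icc (0:ℝ) 1
    · obtain ⟨t, ht⟩ := exists_mem_time_interval hL0 hR1 hmono hLR hleft hright hs
      exact ⟨t, fun _ => ht⟩
    · exact ⟨0, fun h => absurd h hs⟩
  choose v hv using hex
  have huniq : ∀ s t, s ∈ Icc (0:ℝ) 1 → L t ≤ s → s ≤ R t → v s = t := fun s t hs h1 h2 => by
    obtain ⟨-, h3, h4⟩ := hv s hs
    rcases lt_trichotomy (v s) t with h | h | h
    · have := hgap _ _ h
      have := mul_pos hc (sub_pos.2 h)
      linarith
    · exact h
    · have := hgap _ _ h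
      have := mul_pos hc (sub_pos.2 h)
      linarith
  have hvle : ∀ s ∈ Icc (0:ℝ) 1, ∀ s' ∈ Icc (0:ℝ) 1, s ≤ s' → v s ≤ v s' := by
    intro s hs s' hs' h
    by_contra! hlt
    have := hgap _ _ hlt
    have := mul_pos hc (sub_pos.2 hlt)
    linarith [(hv s hs).2.1, (hv s' hs').2.2]
  have hvlip : ∀ s ∈ Icc (0:ℝ) 1, ∀ s' ∈ Icc (0:ℝ) 1, c * |v s' - v s| ≤ |s' - s| := by
    intro s hs s' hs'
    wlog h : s ≤ s' generalizing s s'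
    · rw [abs_sub_comm, abs_sub_comm s']
      exact this s' hs' s hs (le_of_not_ge h)
    rw [abs_of_nonneg (sub_nonneg.2 (hvle s hs s' hs' h)), abs_of_nonneg (sub_nonneg.2 h)]
    rcases eq_or_lt_of_le (hvle s hs s' hs' h) with h' | h'
    · rw [h', sub_self, mul_zero]
      linarith
    · have := hgap _ _ h'
      linarith [(hv s hs).2.2, (hv s' hs').2.1]
  set κ : ℝ → ℝ := fun t => (ζ t - leftVal ζ t) / (R t - L t)
  have hκ : ∀ t ∈ Icc (0:ℝ) 1, κ t * (R t - L t) = ζ t - leftVal ζ t := fun t ht => by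
    by_cases h : ζ t = leftVal ζ t
    · simp [κ, h]
    · exact div_mul_cancel₀ _ (sub_pos.2 (hD t ⟨ht, h⟩)).ne'
  set u : ℝ → ℝ := fun s => leftVal ζ (v s) + κ (v s) * (s - L (v s))
  have hucomb : ∀ s ∈ Icc (0:ℝ) 1, ∃ θ ∈ Icc (0:ℝ) 1,
      u s = leftVal ζ (v s) + θ * (ζ (v s) - leftVal ζ (v s)) := by
    intro s hs
    obtain ⟨h1, h2, h3⟩ := hv s hs
    refine ⟨(s - L (v s)) / (R (v s) - L (v s)),
      ⟨div_nonneg (by linarith) (by linarith), div_le_one_of_le₀ (by linarith) (by linarith)⟩, ?_⟩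
    simp only [u, κ]
    ring
  refine ⟨u, v, ?_, ?_, ?_, ?_⟩
  · rw [Metric.continuousOn_iff]
    intro s hs ε hε
    obtain ⟨ht, hLs, hsR⟩ := hv s hs
    set t := v s
    obtain ⟨δ, hδ, hosc⟩ := hζ.exists_oscillation_le ht (half_pos hε)
    have hK : 0 < |κ t| + 1 := by positivity
    refine ⟨min (c * δ) (ε / 2 / (|κ t| + 1)), by positivity, fun s' hs' hdist => ?_⟩
    rw [Real.dist_eq] at hdist ⊢
    have hlip := hvlip s hs s' hs'
    have hvδ : |v s' - t| < δ :=
      lt_of_mul_lt_mul_left (hlip.trans_lt (hdist.trans_le (min_le_left _ _))) hc.le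
    have hKs : |κ t| * |s' - s| < ε / 2 := by
      have h1 := (lt_div_iff₀ hK).1 (hdist.trans_le (min_le_right _ _))
      nlinarith [abs_nonneg (s' - s)]
    obtain ⟨hr, hl⟩ := hosc (v s') (hv s' hs').1 hvδ
    obtain ⟨θ, hθ, hus'⟩ := hucomb s' hs'
    rcases lt_trichotomy (v s') t with h | h | h
    · have h1 := abs_convexComb_sub_le hθ (hl h).2 (hl h).1
      rw [← hus'] at h1
      have h2 : |leftVal ζ t - u s| ≤ |κ t| * |s' - s| := by
        have : leftVal ζ t - u s = κ t * (L t - s) := by simp only [u, t]; ring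
        rw [this, abs_mul]
        have h3 := hmono _ _ h
        have h4 := (hv s' hs').2.2
        refine mul_le_mul_of_nonneg_left ?_ (abs_nonneg _)
        rw [abs_of_nonpos (by linarith), abs_of_nonpos (by linarith)]
        linarith
      linarith [abs_sub_le (u s') (leftVal ζ t) (u s)]
    · have : u s' - u s = κ t * (s' - s) := by
        change leftVal ζ (v s') + κ (v s') * (s' - L (v s')) - (leftVal ζ t + κ t * (s - L t)) = _
        rw [h]
        ring
      rw [this, abs_mul]
      linarith
    · have h1 := abs_convexComb_sub_le hθ (hr h).2 (hr h).1
      rw [← hus'] at h1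
      have h2 : |ζ t - u s| ≤ |κ t| * |s' - s| := by
        have : ζ t - u s = κ t * (R t - s) := by
          have := hκ t ht
          simp only [u]
          change ζ t - (leftVal ζ t + κ t * (s - L t)) = _
          linear_combination -this
        rw [this, abs_mul]
        have h3 := hmono _ _ h
        have h4 := (hv s' hs').2.1
        refine mul_le_mul_of_nonneg_left ?_ (abs_nonneg _)
        rw [abs_of_nonneg (by linarith), abs_of_nonneg (by linarith)]
        linarith
      linarith [abs_sub_le (u s') (ζ t) (u s)]
  · rw [Metric.continuousOn_iff]
    intro s hs ε hε
    refine ⟨c * ε, by positivity, fun s' hs' hdist => ?_⟩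
    rw [Real.dist_eq] at *
    exact lt_of_mul_lt_mul_left ((hvlip s hs s' hs').trans_lt hdist) hc.le
  · ext ⟨x, t⟩
    constructor
    · rintro ⟨s, hs, hst⟩
      obtain ⟨rfl, rfl⟩ := Prod.mk.inj hst
      obtain ⟨θ, ⟨h0, h1⟩, hus⟩ := hucomb s hs
      refine ⟨(hv s hs).1, ?_⟩
      dsimp only
      rw [hus]
      rcases le_total (leftVal ζ (v s)) (ζ (v s)) with h | h
      · rw [min_eq_left h, max_eq_right h]
        constructor <;> nlinarith
      · rw [min_eq_right h, max_eq_left h]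
        constructor <;> nlinarith
    · rintro ⟨ht, hx⟩
      dsimp only at ht hx
      have hcont : ContinuousOn (fun s => leftVal ζ t + κ t * (s - L t)) (uIcc (L t) (R t)) := by
        fun_prop
      have hx' : x ∈ uIcc (leftVal ζ t + κ t * (L t - L t)) (leftVal ζ t + κ t * (R t - L t)) := by
        rw [hκ t ht, sub_self, mul_zero, add_zero, add_sub_cancel]
        exact hx
      obtain ⟨s, hs, hsx⟩ := intermediate_value_uIcc hcont hx'
      rw [uIcc_of_le (hLR t)] at hs
      have h0 : 0 ≤ L t := by
        rcases eq_or_lt_of_le ht.1 with h | h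
        · rw [← h, hL0]
        · linarith [hmono 0 t h, hLR 0]
      have h1 : R t ≤ 1 := by
        rcases eq_or_lt_of_le ht.2 with h | h
        · rw [h, hR1]
        · linarith [hmono t 1 h, hLR 1]
      have hs01 : s ∈ Icc (0:ℝ) 1 := ⟨h0.trans hs.1, hs.2.trans h1⟩
      have hvs := huniq s t hs01 hs.1 hs.2
      exact ⟨s, hs01, by simp only [u, hvs]; exact Prod.ext hsx rfl⟩
  · intro s₁ h₁ s₂ h₂ h
    rcases eq_or_lt_of_le (hvle s₁ h₁ s₂ h₂ h) with h' | h'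
    · refine Or.inr ⟨h', ?_⟩
      have key : ∀ s, |leftVal ζ (v s) - u s| = |κ (v s)| * |s - L (v s)| := fun s => by
        rw [← abs_mul, abs_sub_comm]
        simp [u]
      have h3 := (hv s₁ h₁).2.1
      rw [key, key, h']
      rw [h'] at h3
      refine mul_le_mul_of_nonneg_left ?_ (abs_nonneg _)
      rw [abs_of_nonneg (by linarith), abs_of_nonneg (by linarith)]
      linarith
    · exact Or.inl h'

theorem exists_mem_Ico_of_lt {t : ℕ → ℝ} {s : ℝ} (h0 : t 0 ≤ s) :
    ∀ k, s < t k → ∃ i < k, s ∈ Ico (t i) (t (i + 1))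
  | 0, h => absurd h0 (not_le.2 h)
  | k + 1, h => by
    rcases lt_or_ge s (t k) with hk | hk
    · obtain ⟨i, hi, his⟩ := exists_mem_Ico_of_lt h0 k hk
      exact ⟨i, hi.trans k.lt_succ_self, his⟩
    · exact ⟨k, k.lt_succ_self, hk, h⟩

theorem exists_mem_Ioc_of_le {t : ℕ → ℝ} {s : ℝ} (h0 : t 0 < s) :
    ∀ k, s ≤ t k → ∃ i < k, s ∈ Ioc (t i) (t (i + 1))
  | 0, h => absurd h0 (not_lt.2 h)
  | k + 1, h => by
    rcases le_or_gt s (t k) with hk | hk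
    · obtain ⟨i, hi, his⟩ := exists_mem_Ioc_of_le h0 k hk
      exact ⟨i, hi.trans k.lt_succ_self, his⟩
    · exact ⟨k, k.lt_succ_self, hk, h⟩

theorem tendsto_nhdsLT_of_const {η : ℝ → ℝ} {a s : ℝ} (has : a < s)
    (h : ∀ r ∈ Ico a s, η r = η a) : Tendsto η (𝓝[<] s) (𝓝 (η a)) :=
  tendsto_const_nhds.congr' (by
    filter_upwards [Ioo_mem_nhdsLT has] with r hr using (h r ⟨hr.1.le, hr.2⟩).symm)

theorem PiecewiseConstant.isCadlag {η : ℝ → ℝ} (hη : PiecewiseConstant η) : IsCadlag η := by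
  obtain ⟨m, t, hm, h0, h1, hlt, hconst⟩ := hη
  refine ⟨fun s hs => ?_, fun s hs => ?_⟩
  · obtain ⟨i, hi, his⟩ := exists_mem_Ico_of_lt (h0.trans_le hs.1) m (hs.2.trans_eq h1.symm)
    refine tendsto_const_nhds.congr' ?_
    filter_upwards [Ioo_mem_nhdsGT his.2] with r hr
    exact hconst i hi s his r ⟨his.1.trans hr.1.le, hr.2⟩
  · obtain ⟨i, hi, his⟩ := exists_mem_Ioc_of_le (h0.trans_lt hs.1) m (hs.2.trans_eq h1.symm)
    exact ⟨η (t i), tendsto_nhdsLT_of_const his.1 fun r hr =>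
      hconst i hi r ⟨hr.1, hr.2.trans_le his.2⟩ _ ⟨le_rfl, hlt i hi⟩⟩

/-- Every nonzero value of a piecewise constant function is attained at a discontinuity. -/
theorem PiecewiseConstant.image_diff_zero_subset {η : ℝ → ℝ} (hη : PiecewiseConstant η) :
    η '' Icc 0 1 \ {0} ⊆ η '' Disc η := by
  classical
  obtain ⟨m, t, hm, h0, h1, hlt, hconst⟩ := hη
  have hmono : ∀ b ≤ m, ∀ a ≤ b, t a ≤ t b := by
    intro b hb a hab
    induction b, hab using Nat.le_induction with
    | base => exact le_rfl
    | succ b hab ih => exact (ih (by omega)).trans (hlt b (by omega)).le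
  rintro y ⟨⟨s, hs, rfl⟩, hy⟩
  have hex : ∃ i, i ≤ m ∧ η (t i) = η s := by
    rcases eq_or_lt_of_le hs.2 with hs1 | hs1
    · exact ⟨m, le_rfl, by rw [h1, hs1]⟩
    · obtain ⟨i, hi, his⟩ := exists_mem_Ico_of_lt (h0.trans_le hs.1) m (hs1.trans_eq h1.symm)
      exact ⟨i, hi.le, hconst i hi _ ⟨le_rfl, hlt i hi⟩ s his⟩
  obtain ⟨him, hi⟩ := Nat.find_spec hex
  have hmin := fun k => Nat.find_min hex (m := k)
  set i := Nat.find hex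
  refine ⟨t i, ⟨⟨?_, ?_⟩, ?_⟩, hi⟩
  · exact h0.symm.trans_le (hmono i him 0 i.zero_le)
  · exact (hmono m le_rfl i him).trans_eq h1
  · rw [hi]
    rcases Nat.eq_zero_or_pos i with hi0 | hi0
    · rw [hi0, h0, leftVal, if_pos rfl]
      exact hy
    · obtain ⟨k, hk⟩ := Nat.exists_eq_add_of_lt hi0
      rw [zero_add] at hk
      have hkm : k < m := by omega
      have hpos : 0 < t i := by
        rw [hk]
        exact (h0.symm.trans_le (hmono k hkm.le 0 k.zero_le)).trans_lt (hlt k hkm)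
      rw [leftVal_eq_of_tendsto hpos.ne' (tendsto_nhdsLT_of_const (a := t k)
        (by rw [hk]; exact hlt k hkm) fun r hr => hconst k hkm r (by rwa [hk] at hr) _
          ⟨le_rfl, hlt k hkm⟩)]
      exact fun h => hmin k (by omega) ⟨hkm.le, h.symm⟩

theorem ncard_image_diff_zero_le {η : ℝ → ℝ} {j : ℕ} (hη : η ∈ Dle j) :
    (η '' Icc 0 1 \ {0}).Finite ∧ (η '' Icc 0 1 \ {0}).ncard ≤ j :=
  ⟨(hη.2.2.2.1.image η).subset hη.1.image_diff_zero_subset,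
    (ncard_le_ncard hη.1.image_diff_zero_subset (hη.2.2.2.1.image η)).trans
      ((ncard_image_le hη.2.2.2.1).trans hη.2.2.2.2)⟩

theorem piecewiseConstant_of_finset {η : ℝ → ℝ} (F : Finset ℝ) (h0F : 0 ∈ F) (h1F : 1 ∈ F)
    (hF : ∀ x ∈ F, x ∈ Icc (0:ℝ) 1)
    (h : ∀ s₁ s₂, 0 ≤ s₁ → s₁ ≤ s₂ → s₂ < 1 → (∀ x ∈ F, x ≤ s₂ → x ≤ s₁) → η s₁ = η s₂) :
    PiecewiseConstant η := by
  classical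
  obtain ⟨m, hm⟩ : ∃ m, F.card = m + 1 :=
    Nat.exists_eq_succ_of_ne_zero (Finset.card_pos.2 ⟨0, h0F⟩).ne'
  set e := F.orderEmbOfFin hm
  have hsurj : ∀ x ∈ F, ∃ k, e k = x := fun x hx => by
    have : x ∈ range e := by rw [F.range_orderEmbOfFin hm]; exact hx
    exact this
  have hmem : ∀ k, e k ∈ F := fun k => F.orderEmbOfFin_mem hm k
  set t : ℕ → ℝ := fun i => e ⟨min i m, by omega⟩
  have ht0 : t 0 = 0 := by
    obtain ⟨k, hk⟩ := hsurj 0 h0F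
    refine le_antisymm ?_ (hF _ (hmem _)).1
    rw [← hk]
    exact e.monotone (Fin.mk_le_of_le_val (by simp))
  have htm : t m = 1 := by
    obtain ⟨k, hk⟩ := hsurj 1 h1F
    refine le_antisymm (hF _ (hmem _)).2 ?_
    rw [← hk]
    exact e.monotone (Fin.le_def.2 (by simp; omega))
  have hlt : ∀ i < m, t i < t (i + 1) := fun i hi =>
    e.strictMono (Fin.lt_def.2 (by simp; omega))
  have hm0 : 0 < m := by
    by_contra hm0
    rw [Nat.eq_zero_of_not_pos hm0] at htm
    rw [ht0] at htm
    exact zero_ne_one htm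
  refine ⟨m, t, hm0, ht0, htm, hlt, fun i hi => ?_⟩
  have key : ∀ s₁ ∈ Ico (t i) (t (i + 1)), ∀ s₂ ∈ Ico (t i) (t (i + 1)), s₁ ≤ s₂ →
      η s₁ = η s₂ := by
    intro s₁ h₁ s₂ h₂ h12
    refine h s₁ s₂ ((hF _ (hmem _)).1.trans h₁.1) h12 (h₂.2.trans_le (hF _ (hmem _)).2)
      fun x hx hxs => ?_
    obtain ⟨k, rfl⟩ := hsurj x hx
    have hk := e.lt_iff_lt.1 (hxs.trans_lt h₂.2)
    refine le_trans (e.monotone (Fin.le_def.2 ?_)) h₁.1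
    have := Fin.lt_def.1 hk
    simp only at this ⊢
    omega
  intro s₁ h₁ s₂ h₂
  rcases le_total s₁ s₂ with h12 | h12
  · exact key s₁ h₁ s₂ h₂ h12
  · exact (key s₂ h₂ s₁ h₁ h12).symm

theorem leftVal_add_mul {ζ : ℝ → ℝ} (hζ : IsCadlag ζ) (z : ℝ) {t : ℝ} (ht : t ∈ Icc (0:ℝ) 1) :
    leftVal (fun s => z * s + ζ s) t = z * t + leftVal ζ t := by
  rcases eq_or_lt_of_le ht.1 with h | h
  · simp [leftVal, ← h]
  · exact leftVal_eq_of_tendsto h.ne' ((((tendsto_id.const_mul z).mono_left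
      nhdsWithin_le_nhds)).add (hζ.tendsto_leftVal ⟨h, ht.2⟩))

theorem IsCadlag.add_mul {ζ : ℝ → ℝ} (hζ : IsCadlag ζ) (z : ℝ) :
    IsCadlag fun s => z * s + ζ s :=
  ⟨fun t ht => ((tendsto_id.const_mul z).mono_left nhdsWithin_le_nhds).add (hζ.1 t ht),
    fun t ht => ⟨z * t + leftVal ζ t, ((tendsto_id.const_mul z).mono_left
      nhdsWithin_le_nhds).add (hζ.tendsto_leftVal ht)⟩⟩

theorem le_leftVal_of_monotoneOn {η : ℝ → ℝ} (hη : IsCadlag η) (hm : MonotoneOn η (Icc 0 1))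
    {r t : ℝ} (hr : 0 ≤ r) (hrt : r < t) (ht : t ≤ 1) : η r ≤ leftVal η t := by
  refine ge_of_tendsto (hη.tendsto_leftVal ⟨hr.trans_lt hrt, ht⟩) ?_
  filter_upwards [Ioo_mem_nhdsLT hrt] with s hs
  exact hm ⟨hr, hrt.le.trans ht⟩ ⟨hr.trans hs.1.le, hs.2.le.trans ht⟩ hs.1.le

theorem leftVal_le_of_monotoneOn {η : ℝ → ℝ} (hη : IsCadlag η) (hm : MonotoneOn η (Icc 0 1))
    (h0 : 0 ≤ η 0) {t : ℝ} (ht : t ∈ Icc (0:ℝ) 1) : leftVal η t ≤ η t := by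
  rcases eq_or_lt_of_le ht.1 with h | h
  · simpa [leftVal, ← h] using h0
  · refine le_of_tendsto (hη.tendsto_leftVal ⟨h, ht.2⟩) ?_
    filter_upwards [Ioo_mem_nhdsLT h] with s hs
    exact hm ⟨hs.1.le, hs.2.le.trans ht.2⟩ ht hs.2.le

theorem leftVal_nonneg_of_monotoneOn {η : ℝ → ℝ} (hη : IsCadlag η) (hm : MonotoneOn η (Icc 0 1))
    (h0 : 0 ≤ η 0) {t : ℝ} (ht : t ∈ Icc (0:ℝ) 1) : 0 ≤ leftVal η t := by
  rcases eq_or_lt_of_le ht.1 with h | h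
  · simp [leftVal, ← h]
  · exact h0.trans (le_leftVal_of_monotoneOn hη hm le_rfl h ht.2)

/-- A monotone càdlàg function whose range on `[0,1]` has at most `j` nonzero values belongs
to `Dle j`. -/
theorem mem_Dle_of_ncard_image_le {η : ℝ → ℝ} {j : ℕ} (hη : IsCadlag η)
    (hm : MonotoneOn η (Icc 0 1)) (h0 : 0 ≤ η 0) (hfin : (η '' Icc 0 1 \ {0}).Finite)
    (hcard : (η '' Icc 0 1 \ {0}).ncard ≤ j) : η ∈ Dle j := by
  classical
  have hinj : InjOn η (Disc η) := by
    intro s hs t ht hst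
    by_contra hne
    wlog h : s < t generalizing s t
    · exact this ht hs hst.symm (Ne.symm hne) (lt_of_le_of_ne (not_lt.1 h) (Ne.symm hne))
    exact ht.2 (le_antisymm (hst ▸ le_leftVal_of_monotoneOn hη hm hs.1.1 h ht.1.2)
      (leftVal_le_of_monotoneOn hη hm h0 ht.1))
  have hmaps : MapsTo η (Disc η) (η '' Icc 0 1 \ {0}) := fun t ht =>
    ⟨mem_image_of_mem _ ht.1, fun h => ht.2 (le_antisymm
      (h.trans_le (leftVal_nonneg_of_monotoneOn hη hm h0 ht.1))
      (leftVal_le_of_monotoneOn hη hm h0 ht.1))⟩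
  refine ⟨?_, hm, h0, Finite.of_injOn hmaps hinj hfin,
    (ncard_le_ncard_of_injOn η hmaps hinj hfin).trans hcard⟩
  have himg : (η '' Icc 0 1).Finite := (hfin.insert 0).subset fun y hy => by
    by_cases h : y = 0
    · exact Or.inl h
    · exact Or.inr ⟨hy, h⟩
  set τ : ℝ → ℝ := fun y => sInf {t | t ∈ Icc (0:ℝ) 1 ∧ y ≤ η t}
  have hbdd : ∀ y, BddBelow {t | t ∈ Icc (0:ℝ) 1 ∧ y ≤ η t} := fun y => ⟨0, fun t ht => ht.1.1⟩
  have hτle : ∀ s ∈ Icc (0:ℝ) 1, τ (η s) ≤ s := fun s hs => csInf_le (hbdd _) ⟨hs, le_rfl⟩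
  have hτ0 : ∀ s ∈ Icc (0:ℝ) 1, 0 ≤ τ (η s) := fun s hs =>
    le_csInf ⟨s, hs, le_rfl⟩ fun t ht => ht.1.1
  refine piecewiseConstant_of_finset (insert 0 (insert 1 (himg.toFinset.image τ))) (by simp)
    (by simp) ?_ ?_
  · intro x hx
    simp only [Finset.mem_insert, Finset.mem_image, Finite.mem_toFinset] at hx
    rcases hx with rfl | rfl | ⟨_, ⟨s, hs, rfl⟩, rfl⟩
    · simp
    · simp
    · exact ⟨hτ0 s hs, (hτle s hs).trans hs.2⟩
  · intro s₁ s₂ h₁ h12 h₂ hF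
    have hs₁ : s₁ ∈ Icc (0:ℝ) 1 := ⟨h₁, h12.trans h₂.le⟩
    have hs₂ : s₂ ∈ Icc (0:ℝ) 1 := ⟨h₁.trans h12, h₂.le⟩
    refine le_antisymm (hm hs₁ hs₂ h12) ?_
    have hle : τ (η s₂) ≤ s₁ := hF _ (by
      simp only [Finset.mem_insert, Finset.mem_image, Finite.mem_toFinset]
      exact Or.inr (Or.inr ⟨_, ⟨s₂, hs₂, rfl⟩, rfl⟩)) (hτle s₂ hs₂)
    refine ge_of_tendsto (hη.1 s₁ ⟨h₁, h12.trans_lt h₂⟩) ?_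
    filter_upwards [Ioo_mem_nhdsGT (h12.trans_lt h₂)] with r hr
    have hne : {t | t ∈ Icc (0:ℝ) 1 ∧ η s₂ ≤ η t}.Nonempty := ⟨s₂, hs₂, le_rfl⟩
    obtain ⟨q, hq, hqr⟩ := exists_lt_of_csInf_lt hne (hle.trans_lt hr.1)
    exact hq.2.trans (hm hq.1 ⟨h₁.trans hr.1.le, hr.2.le⟩ hqr.le)

theorem bddAbove_range_abs_sub {f g : ℝ → ℝ} (hf : ContinuousOn f (Icc 0 1))
    (hg : ContinuousOn g (Icc 0 1)) : BddAbove (range fun s : Icc (0:ℝ) 1 => |f s - g s|) := by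
  have := (isCompact_Icc.image_of_continuousOn (hf.sub hg).abs).bddAbove
  rwa [image_eq_range] at this

theorem exists_extGraph_near_of_dM1_lt {ξ ζ : ℝ → ℝ} (hξ : IsCadlag ξ) (hζ : IsCadlag ζ) {ε : ℝ}
    (h : dM1 ξ ζ < ε) {p : ℝ × ℝ} (hp : p ∈ extGraph ζ) :
    ∃ q ∈ extGraph ξ, |q.1 - p.1| < ε ∧ |q.2 - p.2| < ε := by
  obtain ⟨u, v, huv⟩ := hξ.exists_paramRep
  obtain ⟨u', v', huv'⟩ := hζ.exists_paramRep
  obtain ⟨_, ⟨u₁, v₁, u₂, v₂, h₁, h₂, rfl⟩, hlt⟩ := exists_lt_of_csInf_lt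
    (by exact ⟨_, u, v, u', v', huv, huv', rfl⟩) h
  rw [← h₂.2.2.1] at hp
  obtain ⟨s, hs, rfl⟩ := hp
  refine ⟨(u₁ s, v₁ s), by rw [← h₁.2.2.1]; exact mem_image_of_mem _ hs, ?_, ?_⟩
  · exact (le_ciSup (bddAbove_range_abs_sub h₁.1 h₂.1) ⟨s, hs⟩).trans_lt
      ((le_max_left _ _).trans_lt hlt)
  · exact (le_ciSup (bddAbove_range_abs_sub h₁.2.1 h₂.2.1) ⟨s, hs⟩).trans_lt
      ((le_max_right _ _).trans_lt hlt)

/-- If `ξ n → ζ` and `ξ n` is `z · id` plus a monotone function `η n`, then every value of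
`ζ - z · id` is approximated by points of the completed graphs of the `η n`. -/
theorem eventually_exists_near {z : ℝ} {ξ η : ℕ → ℝ → ℝ} {ζ : ℝ → ℝ}
    (hη : ∀ n, IsCadlag (η n)) (hm : ∀ n, MonotoneOn (η n) (Icc 0 1)) (h0 : ∀ n, 0 ≤ η n 0)
    (hξ : ∀ n, ξ n = fun t => z * t + η n t) (hζ : IsCadlag ζ)
    (hconv : Tendsto (fun n => dM1 (ξ n) ζ) atTop (𝓝 0)) {t : ℝ} (ht : t ∈ Icc (0:ℝ) 1)
    {ε : ℝ} (hε : 0 < ε) :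
    ∀ᶠ n in atTop, ∃ τ ∈ Icc (0:ℝ) 1, ∃ x, |τ - t| < ε ∧ |x - (ζ t - z * t)| < ε ∧
      leftVal (η n) τ ≤ x ∧ x ≤ η n τ := by
  have hK : 0 < |z| + 1 := by positivity
  have hε' : 0 < ε / (|z| + 1) := by positivity
  filter_upwards [hconv.eventually_lt_const hε'] with n hn
  have hcad : IsCadlag (ξ n) := by
    rw [hξ n]
    exact (hη n).add_mul z
  obtain ⟨⟨y, τ⟩, ⟨hτ, hy⟩, h1, h2⟩ := exists_extGraph_near_of_dM1_lt hcad hζ hn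
    (p := (ζ t, t)) ⟨ht, min_le_right _ _, le_max_right _ _⟩
  dsimp only at hτ hy h1 h2
  have hle := leftVal_le_of_monotoneOn (hη n) (hm n) (h0 n) hτ
  rw [hξ n, leftVal_add_mul (hη n) z hτ, min_eq_left (by linarith),
    max_eq_right (by linarith)] at hy
  rw [lt_div_iff₀ hK] at h1 h2
  have h3 : |z * (τ - t)| = |z| * |τ - t| := abs_mul _ _
  refine ⟨τ, hτ, y - z * τ, ?_, ?_, by linarith [hy.1], by linarith [hy.2]⟩
  · nlinarith [abs_nonneg z, abs_nonneg (τ - t)]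
  · have h4 : y - z * τ - (ζ t - z * t) = (y - ζ t) - z * (τ - t) := by ring
    rw [h4]
    have hlt : |y - ζ t| < ε / (|z| + 1) := (lt_div_iff₀ hK).2 h1
    have hlt2 : |τ - t| < ε / (|z| + 1) := (lt_div_iff₀ hK).2 h2
    have h5 : ε / (|z| + 1) * (|z| + 1) = ε := div_mul_cancel₀ _ hK.ne'
    have h6 := abs_sub (y - ζ t) (z * (τ - t))
    nlinarith [abs_nonneg z]

theorem exists_separation {V : Finset ℝ} (hV : ∀ y ∈ V, 0 < y) :
    ∃ δ > 0, (∀ y ∈ V, δ < y) ∧ ∀ y ∈ V, ∀ y' ∈ V, y < y' → y + δ < y' - δ := by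
  have h1 : ∀ᶠ δ in 𝓝[>] (0:ℝ), ∀ y ∈ V, δ < y := (Filter.eventually_all_finset V).2 fun y hy =>
    nhdsWithin_le_nhds (Iio_mem_nhds (hV y hy))
  have h2 : ∀ᶠ δ in 𝓝[>] (0:ℝ), ∀ y ∈ V, ∀ y' ∈ V, y < y' → y + δ < y' - δ :=
    (Filter.eventually_all_finset V).2 fun y hy => (Filter.eventually_all_finset V).2 fun y' hy' => by
      by_cases h : y < y'
      · filter_upwards [nhdsWithin_le_nhds (Iio_mem_nhds (half_pos (sub_pos.2 h)))] with δ hδ _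
        have : δ < (y' - y) / 2 := hδ
        linarith
      · exact Eventually.of_forall fun _ h' => absurd h' h
  obtain ⟨δ, ⟨hδ, h⟩, h'⟩ := ((eventually_mem_nhdsWithin.and h1).and h2).exists
  exact ⟨δ, hδ, h, h'⟩

/-- **Lemma (`lem: closeness of D_<j`)**: for every `j ≥ 0` and `z ∈ ℝ`, the set
`D̲^z_{≤ j}` is (sequentially) closed in `(D[0,1], d_{M₁'})`. -/
theorem DleZ_closed (j : ℕ) (z : ℝ) (ξ : ℕ → ℝ → ℝ) (ζ : ℝ → ℝ)
    (hmem : ∀ n, ξ n ∈ DleZ z j) (hζ : IsCadlag ζ)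
    (hconv : Filter.Tendsto (fun n => dM1 (ξ n) ζ) Filter.atTop (nhds 0)) :
    ζ ∈ DleZ z j := by
  choose η hη hξ using hmem
  have hcad : ∀ n, IsCadlag (η n) := fun n => (hη n).1.isCadlag
  have hmon : ∀ n, MonotoneOn (η n) (Icc 0 1) := fun n => (hη n).2.1
  have hη0 : ∀ n, 0 ≤ η n 0 := fun n => (hη n).2.2.1
  set g : ℝ → ℝ := fun t => ζ t - z * t with hg
  have happrox : ∀ {t}, t ∈ Icc (0:ℝ) 1 → ∀ {ε : ℝ}, 0 < ε → ∀ᶠ n in atTop,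
      ∃ τ ∈ Icc (0:ℝ) 1, ∃ x, |τ - t| < ε ∧ |x - g t| < ε ∧ leftVal (η n) τ ≤ x ∧ x ≤ η n τ :=
    fun ht _ hε => eventually_exists_near hcad hmon hη0 hξ hζ hconv ht hε
  have hgcad : IsCadlag g := by
    convert hζ.add_mul (-z) using 2
    simp only [hg]
    ring
  have hgmon : MonotoneOn g (Icc 0 1) := by
    intro s hs t ht hst
    rcases eq_or_lt_of_le hst with rfl | hst
    · exact le_rfl
    refine le_of_forall_pos_le_add fun ε hε => ?_
    have hε' : 0 < min (ε / 2) ((t - s) / 2) :=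
      lt_min (half_pos hε) (half_pos (sub_pos.2 hst))
    obtain ⟨n, ⟨τ, hτ, x, h1, h2, h3, h4⟩, ⟨τ', hτ', x', h1', h2', h3', h4'⟩⟩ :=
      ((happrox hs hε').and (happrox ht hε')).exists
    simp only [lt_min_iff, abs_lt] at h1 h2 h1' h2'
    have := le_leftVal_of_monotoneOn (hcad n) (hmon n) hτ.1
      (show τ < τ' by linarith [h1.2.2, h1'.2.1]) hτ'.2
    linarith [h2.1.1, h2'.1.2]
  have hg0 : 0 ≤ g 0 := by
    refine le_of_forall_pos_le_add fun ε hε => ?_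
    obtain ⟨n, τ, hτ, x, -, h2, h3, -⟩ := (happrox ⟨le_rfl, zero_le_one⟩ hε).exists
    linarith [(abs_lt.1 h2).2, leftVal_nonneg_of_monotoneOn (hcad n) (hmon n) (hη0 n) hτ]
  have hval : ∀ y ∈ g '' Icc 0 1 \ {0}, ∀ δ > 0, ∀ᶠ n in atTop, ∃ τ ∈ Icc (0:ℝ) 1,
      y - δ < η n τ ∧ ((∃ y' ∈ g '' Icc 0 1 \ {0}, y < y') → η n τ < y + δ) := by
    rintro _ ⟨⟨s, hs, rfl⟩, -⟩ δ hδ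
    rcases eq_or_lt_of_le hs.2 with hs1 | hs1
    · filter_upwards [happrox hs hδ] with n hn
      obtain ⟨τ, hτ, x, -, h2, -, h4⟩ := hn
      refine ⟨τ, hτ, by linarith [(abs_lt.1 h2).1], ?_⟩
      rintro ⟨_, ⟨⟨t, ht, rfl⟩, -⟩, hlt⟩
      exact absurd (hgmon ht hs (ht.2.trans_eq hs1.symm)) (not_le.2 hlt)
    · obtain ⟨t, hgt, hst, ht1⟩ := (((hgcad.1 s ⟨hs.1, hs1⟩).eventually_lt_const
        (show g s < g s + δ / 2 by linarith)).and (Ioo_mem_nhdsGT hs1)).exists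
      have ht : t ∈ Icc (0:ℝ) 1 := ⟨hs.1.trans hst.le, ht1.le⟩
      have hε : 0 < min (δ / 2) ((t - s) / 2) := lt_min (half_pos hδ) (half_pos (sub_pos.2 hst))
      filter_upwards [happrox hs hε, happrox ht hε] with n hn hn'
      obtain ⟨τ, hτ, x, h1, h2, h3, h4⟩ := hn
      obtain ⟨τ', hτ', x', h1', h2', h3', h4'⟩ := hn'
      simp only [lt_min_iff, abs_lt] at h1 h2 h1' h2'
      have := le_leftVal_of_monotoneOn (hcad n) (hmon n) hτ.1
        (show τ < τ' by linarith [h1.2.2, h1'.2.1]) hτ'.2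
      exact ⟨τ, hτ, by linarith [h2.1.1], fun _ => by linarith [h2'.1.2]⟩
  have hcard : ∀ V : Finset ℝ, (V : Set ℝ) ⊆ g '' Icc 0 1 \ {0} → V.card ≤ j := by
    intro V hV
    have hpos : ∀ y ∈ V, 0 < y := by
      intro y hy
      obtain ⟨⟨s, hs, rfl⟩, hne⟩ := hV hy
      exact lt_of_le_of_ne (hg0.trans (hgmon ⟨le_rfl, zero_le_one⟩ hs hs.1)) (Ne.symm hne)
    obtain ⟨δ, hδ, hδV, hgap⟩ := exists_separation hpos
    obtain ⟨n, hn⟩ := ((Filter.eventually_all_finset V).2 fun y hy => hval y (hV hy) δ hδ).exists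
    choose! τ hτ hlow hup using hn
    obtain ⟨hfin, hle⟩ := ncard_image_diff_zero_le (hη n)
    have hlt : ∀ y ∈ V, ∀ y' ∈ V, y < y' → η n (τ y) < η n (τ y') := fun y hy y' hy' h =>
      ((hup y hy ⟨y', hV hy', h⟩).trans (hgap y hy y' hy' h)).trans (hlow y' hy')
    have hinj : InjOn (fun y => η n (τ y)) (V : Set ℝ) :=
      StrictMonoOn.injOn fun y hy y' hy' h => hlt y hy y' hy' h
    rw [← ncard_coe_finset V]
    refine (ncard_le_ncard_of_injOn _ (fun y hy => ?_) hinj hfin).trans hle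
    exact ⟨mem_image_of_mem _ (hτ y hy), fun h => by
      have h1 := hlow y hy
      have h2 := hδV y hy
      rw [mem_singleton_iff] at h
      linarith⟩
  have hfin : (g '' Icc 0 1 \ {0}).Finite := by
    by_contra hinf
    obtain ⟨V, hV, hc⟩ := Set.Infinite.exists_subset_card_eq hinf (j + 1)
    have := hcard V hV
    omega
  have hncard : (g '' Icc 0 1 \ {0}).ncard ≤ j := by
    rw [ncard_eq_toFinset_card _ hfin]
    exact hcard _ (by simp)
  exact ⟨g, mem_Dle_of_ncard_image_le hgcad hgmon hg0 hfin hncard, by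
    funext t
    simp only [hg]
    ring⟩
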